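/- Let M̃ be a finite-dimensional vector space over K = ℂ((t)) and let θ be a K-linear endomorphism of M̃. Then (M̃, θ) is regular — i.e. there exists a lattice E of M̃ with tθ(E) ⊆ E — if and only if every V₀-lattice of (M̃, θ) is a lattice, i.e. is finitely generated as a ℂ[[t]]-module. -/

import Mathlib

/-!
STATEMENT 3: (M̃, θ) is regular — there exists a lattice E with tθ(E) ⊆ E — if and
only if every V₀-lattice of (M̃, θ) is a lattice (finitely generated over ℂ[[t]]).
-/

noncomputable section

/-- The element `t` of `K = ℂ((t))`. -/
def tLS : LaurentSeries ℂ := HahnSeries.single 1 1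

/-- `E` is a lattice of `M`: a finitely generated `ℂ[[t]]`-submodule generating `M`
after inverting `t`. -/
def IsLattice {M : Type*} [AddCommGroup M] [Module (LaurentSeries ℂ) M]
    [Module ℂ M] [IsScalarTower ℂ (LaurentSeries ℂ) M] (E : Submodule ℂ M) : Prop :=
  (∀ f : PowerSeries ℂ, ∀ u ∈ E, ((f : LaurentSeries ℂ) • u) ∈ E) ∧
  (∃ s : Finset M, (s : Set M) ⊆ (E : Set M) ∧
    ∀ u ∈ E, u ∈ Submodule.span ℂ
      { y : M | ∃ (f : PowerSeries ℂ), ∃ x ∈ s, y = (f : LaurentSeries ℂ) • x }) ∧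
  (∀ m : M, ∃ n : ℕ, (tLS ^ n) • m ∈ E)

/-- `U` is a V₀-lattice of `(M, θ)`: it is a `ℂ[[t]]`-submodule of `M`, stable under
`tθ`, finitely generated over the algebra `ℂ[[t]][tθ]`, and generates `M` after
inverting `t`. -/
def IsV0Lattice {M : Type*} [AddCommGroup M] [Module (LaurentSeries ℂ) M]
    [Module ℂ M] [IsScalarTower ℂ (LaurentSeries ℂ) M]
    (θ : M →ₗ[LaurentSeries ℂ] M) (U : Submodule ℂ M) : Prop :=
  (∀ f : PowerSeries ℂ, ∀ u ∈ U, ((f : LaurentSeries ℂ) • u) ∈ U) ∧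
  (∀ u ∈ U, (tLS • θ) u ∈ U) ∧
  (∃ s : Finset M, (s : Set M) ⊆ (U : Set M) ∧
    ∀ u ∈ U, u ∈ Submodule.span ℂ
      { y : M | ∃ (f : PowerSeries ℂ) (n : ℕ), ∃ x ∈ s,
          y = (f : LaurentSeries ℂ) • (((tLS • θ) ^ n) x) }) ∧
  (∀ m : M, ∃ n : ℕ, (tLS ^ n) • m ∈ U)

lemma tLS_pow_eq_coe (n : ℕ) :
    tLS ^ n = (((PowerSeries.X : PowerSeries ℂ) ^ n : PowerSeries ℂ) : LaurentSeries ℂ) := by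
  rw [PowerSeries.coe_pow, PowerSeries.coe_X, tLS]

lemma tLS_ne_zero : tLS ≠ 0 := HahnSeries.single_ne_zero one_ne_zero

lemma exists_tLS_pow_mul_eq_coe (c : LaurentSeries ℂ) :
    ∃ (n : ℕ) (f : PowerSeries ℂ), tLS ^ n * c = (f : LaurentSeries ℂ) := by
  obtain ⟨⟨f, ⟨_, n, rfl⟩⟩, h⟩ :=
    IsLocalization.surj (Submonoid.powers (PowerSeries.X : PowerSeries ℂ)) c
  refine ⟨n, f, ?_⟩
  rw [tLS_pow_eq_coe, mul_comm]
  exact h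

section

variable {M : Type*} [AddCommGroup M] [Module (LaurentSeries ℂ) M]

lemma tLS_pow_smul_mem_of_le {S : Type*} [SetLike S M] {E : S}
    (hE : ∀ f : PowerSeries ℂ, ∀ u ∈ E, (f : LaurentSeries ℂ) • u ∈ E)
    {m : M} {n k : ℕ} (hnk : n ≤ k) (h : tLS ^ n • m ∈ E) : tLS ^ k • m ∈ E := by
  obtain ⟨d, rfl⟩ := Nat.exists_eq_add_of_le' hnk
  rw [pow_add, mul_smul, tLS_pow_eq_coe d]
  exact hE _ _ h

lemma exists_tLS_pow_smul_mem_of_finset {S : Type*} [SetLike S M] {E : S}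
    (hE : ∀ f : PowerSeries ℂ, ∀ u ∈ E, (f : LaurentSeries ℂ) • u ∈ E)
    (ht : ∀ m : M, ∃ n : ℕ, tLS ^ n • m ∈ E) (s : Finset M) :
    ∃ n : ℕ, ∀ x ∈ s, tLS ^ n • x ∈ E := by
  choose n hn using ht
  exact ⟨s.sup n, fun x hx => tLS_pow_smul_mem_of_le hE (Finset.le_sup hx) (hn x)⟩

variable [Module ℂ M]

/-- A `ℂ`-subspace closed under power series, as a `ℂ[[t]]`-submodule. -/
def powerSeriesSubmodule [Module (PowerSeries ℂ) M]
    [IsScalarTower (PowerSeries ℂ) (LaurentSeries ℂ) M] (E : Submodule ℂ M)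
    (hE : ∀ f : PowerSeries ℂ, ∀ u ∈ E, (f : LaurentSeries ℂ) • u ∈ E) :
    Submodule (PowerSeries ℂ) M where
  carrier := E
  add_mem' := E.add_mem
  zero_mem' := E.zero_mem
  smul_mem' f u hu := by
    rw [← algebraMap_smul (LaurentSeries ℂ) f u]
    exact hE f u hu

/-- The `ℂ[[t]][tθ]`-submodule generated by `s`. -/
def v0Span (θ : M →ₗ[LaurentSeries ℂ] M) (s : Set M) : Submodule ℂ M :=
  Submodule.span ℂ { y : M | ∃ (f : PowerSeries ℂ) (n : ℕ), ∃ x ∈ s,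
    y = (f : LaurentSeries ℂ) • (((tLS • θ) ^ n) x) }

lemma subset_v0Span (θ : M →ₗ[LaurentSeries ℂ] M) (s : Set M) : s ⊆ v0Span θ s :=
  fun x hx => Submodule.subset_span ⟨1, 0, x, hx, by simp⟩

variable [IsScalarTower ℂ (LaurentSeries ℂ) M]

lemma complex_smul_eq_C_smul (c : ℂ) (m : M) :
    c • m = (HahnSeries.C c : LaurentSeries ℂ) • m := by
  rw [← mul_one (HahnSeries.C c : LaurentSeries ℂ), HahnSeries.C_mul_eq_smul, smul_assoc, one_smul]

lemma laurentSeries_smul_complex_smul (k : LaurentSeries ℂ) (c : ℂ) (m : M) :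
    k • c • m = c • k • m := by
  rw [complex_smul_eq_C_smul, complex_smul_eq_C_smul, smul_smul, smul_smul, mul_comm]

/-- The `ℂ`-span of the power series multiples of `s` is the `ℂ[[t]]`-span of `s`. -/
lemma mem_span_powerSeries_iff [Module (PowerSeries ℂ) M]
    [IsScalarTower (PowerSeries ℂ) (LaurentSeries ℂ) M] (s : Set M) (u : M) :
    u ∈ Submodule.span ℂ
        { y : M | ∃ (f : PowerSeries ℂ), ∃ x ∈ s, y = (f : LaurentSeries ℂ) • x } ↔
      u ∈ Submodule.span (PowerSeries ℂ) s := by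
  constructor
  · intro hu
    induction hu using Submodule.span_induction with
    | mem y hy =>
      obtain ⟨f, x, hx, rfl⟩ := hy
      have : (f : LaurentSeries ℂ) • x = f • x := algebraMap_smul (LaurentSeries ℂ) f x
      rw [this]
      exact Submodule.smul_mem _ _ (Submodule.subset_span hx)
    | zero => exact Submodule.zero_mem _
    | add x y _ _ hx hy => exact Submodule.add_mem _ hx hy
    | smul c x _ hx =>
      have : c • x = (PowerSeries.C c : PowerSeries ℂ) • x := by
        rw [← algebraMap_smul (LaurentSeries ℂ) (PowerSeries.C c : PowerSeries ℂ) x,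
          LaurentSeries.coe_algebraMap, HahnSeries.ofPowerSeries_C, complex_smul_eq_C_smul]
      rw [this]
      exact Submodule.smul_mem _ _ hx
  · intro hu
    induction hu using Submodule.span_induction with
    | mem x hx => exact Submodule.subset_span ⟨1, x, hx, by simp⟩
    | zero => exact Submodule.zero_mem _
    | add x y _ _ hx hy => exact Submodule.add_mem _ hx hy
    | smul g x h hx =>
      clear h
      rw [← algebraMap_smul (LaurentSeries ℂ) g x]
      induction hx using Submodule.span_induction with
      | mem y hy =>
        obtain ⟨f, x, hx, rfl⟩ := hy
        refine Submodule.subset_span ⟨g * f, x, hx, ?_⟩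
        rw [PowerSeries.coe_mul, mul_smul]
        rfl
      | zero => simp
      | add x y _ _ hx hy => rw [smul_add]; exact Submodule.add_mem _ hx hy
      | smul c x _ hx => rw [laurentSeries_smul_complex_smul]; exact Submodule.smul_mem _ _ hx

lemma isLattice_iff_fg [Module (PowerSeries ℂ) M]
    [IsScalarTower (PowerSeries ℂ) (LaurentSeries ℂ) M] (E : Submodule ℂ M) :
    IsLattice E ↔
      (∃ hE : ∀ f : PowerSeries ℂ, ∀ u ∈ E, (f : LaurentSeries ℂ) • u ∈ E,
        (powerSeriesSubmodule E hE).FG) ∧ ∀ m : M, ∃ n : ℕ, tLS ^ n • m ∈ E := by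
  constructor
  · rintro ⟨hE, ⟨s, hs, hspan⟩, ht⟩
    refine ⟨⟨hE, s, le_antisymm (Submodule.span_le.2 hs) fun u hu => ?_⟩, ht⟩
    exact (mem_span_powerSeries_iff _ u).1 (hspan u hu)
  · rintro ⟨⟨hE, s, hs⟩, ht⟩
    refine ⟨hE, ⟨s, ?_, fun u hu => ?_⟩, ht⟩
    · intro x hx
      have : x ∈ powerSeriesSubmodule E hE := hs ▸ Submodule.subset_span hx
      exact this
    · refine (mem_span_powerSeries_iff _ u).2 ?_
      rw [hs]
      exact hu

/-- A `ℂ[[t]]`-submodule commensurable with a lattice is itself a lattice. -/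
lemma IsLattice.of_tLS_pow_smul_mem {E U : Submodule ℂ M} (hE : IsLattice E)
    (hU : ∀ f : PowerSeries ℂ, ∀ u ∈ U, (f : LaurentSeries ℂ) • u ∈ U)
    (ht : ∀ m : M, ∃ n : ℕ, tLS ^ n • m ∈ U) (n : ℕ) (hn : ∀ u ∈ U, tLS ^ n • u ∈ E) :
    IsLattice U := by
  let : Module (PowerSeries ℂ) M :=
    Module.compHom M (algebraMap (PowerSeries ℂ) (LaurentSeries ℂ))
  have : IsScalarTower (PowerSeries ℂ) (LaurentSeries ℂ) M :=
    IsScalarTower.of_algebraMap_smul fun _ _ => rfl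
  obtain ⟨⟨hE', hfg⟩, -⟩ := (isLattice_iff_fg E).1 hE
  refine (isLattice_iff_fg U).2 ⟨⟨hU, ?_⟩, ht⟩
  have hX : ∀ m : M, (PowerSeries.X ^ n : PowerSeries ℂ) • m = tLS ^ n • m := fun m => by
    rw [tLS_pow_eq_coe]
    rfl
  have hinj : Function.Injective
      (LinearMap.lsmul (PowerSeries ℂ) M (PowerSeries.X ^ n : PowerSeries ℂ)) := by
    intro x y hxy
    simp only [LinearMap.lsmul_apply, hX] at hxy
    exact smul_right_injective M (pow_ne_zero n tLS_ne_zero) hxy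
  refine Submodule.fg_of_fg_map_injective _ hinj (hfg.of_le ?_)
  rintro _ ⟨u, hu, rfl⟩
  rw [LinearMap.lsmul_apply, hX]
  exact hn u hu

lemma coe_smul_mem_v0Span (θ : M →ₗ[LaurentSeries ℂ] M) (s : Set M) (g : PowerSeries ℂ) (u : M)
    (hu : u ∈ v0Span θ s) : (g : LaurentSeries ℂ) • u ∈ v0Span θ s := by
  induction hu using Submodule.span_induction with
  | mem y hy =>
    obtain ⟨f, n, x, hx, rfl⟩ := hy
    refine Submodule.subset_span ⟨g * f, n, x, hx, ?_⟩
    rw [PowerSeries.coe_mul, mul_smul]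
  | zero => simp
  | add x y _ _ hx hy => rw [smul_add]; exact Submodule.add_mem _ hx hy
  | smul c x _ hx => rw [laurentSeries_smul_complex_smul]; exact Submodule.smul_mem _ _ hx

lemma tLS_smul_mem_v0Span (θ : M →ₗ[LaurentSeries ℂ] M) (s : Set M) (u : M)
    (hu : u ∈ v0Span θ s) : (tLS • θ) u ∈ v0Span θ s := by
  induction hu using Submodule.span_induction with
  | mem y hy =>
    obtain ⟨f, n, x, hx, rfl⟩ := hy
    refine Submodule.subset_span ⟨f, n + 1, x, hx, ?_⟩
    rw [map_smul, pow_succ', Module.End.mul_apply]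
  | zero => simp
  | add x y _ _ hx hy => rw [map_add]; exact Submodule.add_mem _ hx hy
  | smul c x _ hx => rw [LinearMap.map_smul_of_tower]; exact Submodule.smul_mem _ _ hx

lemma isV0Lattice_v0Span (θ : M →ₗ[LaurentSeries ℂ] M) (s : Finset M)
    (hs : Submodule.span (LaurentSeries ℂ) (s : Set M) = ⊤) : IsV0Lattice θ (v0Span θ s) := by
  refine ⟨coe_smul_mem_v0Span θ s, tLS_smul_mem_v0Span θ s,
    ⟨s, subset_v0Span θ s, fun u hu => hu⟩, fun m => ?_⟩
  have hm : m ∈ Submodule.span (LaurentSeries ℂ) (s : Set M) := hs ▸ Submodule.mem_top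
  induction hm using Submodule.span_induction with
  | mem x hx => exact ⟨0, by simpa using subset_v0Span θ s hx⟩
  | zero => exact ⟨0, by simp⟩
  | add x y _ _ hx hy =>
    obtain ⟨n, hn⟩ := hx
    obtain ⟨k, hk⟩ := hy
    refine ⟨max n k, ?_⟩
    rw [smul_add]
    exact Submodule.add_mem _
      (tLS_pow_smul_mem_of_le (coe_smul_mem_v0Span θ s) (le_max_left n k) hn)
      (tLS_pow_smul_mem_of_le (coe_smul_mem_v0Span θ s) (le_max_right n k) hk)
  | smul c x _ hx =>
    obtain ⟨n, hn⟩ := hx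
    obtain ⟨k, f, hf⟩ := exists_tLS_pow_mul_eq_coe c
    refine ⟨k + n, ?_⟩
    have : tLS ^ (k + n) • c • x = (f : LaurentSeries ℂ) • tLS ^ n • x := by
      rw [← hf, smul_smul, smul_smul, pow_add, mul_right_comm]
    rw [this]
    exact coe_smul_mem_v0Span θ s f _ hn

end

theorem regular_iff_every_v0Lattice_is_lattice
    {M : Type*} [AddCommGroup M] [Module (LaurentSeries ℂ) M]
    [Module ℂ M] [IsScalarTower ℂ (LaurentSeries ℂ) M]
    [FiniteDimensional (LaurentSeries ℂ) M]
    (θ : M →ₗ[LaurentSeries ℂ] M) :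
    (∃ E : Submodule ℂ M, IsLattice E ∧ ∀ u ∈ E, (tLS • θ) u ∈ E) ↔
      (∀ U : Submodule ℂ M, IsV0Lattice θ U → IsLattice U) := by
  constructor
  · rintro ⟨E, hE, hθ⟩ U ⟨hU, -, ⟨s, -, hspan⟩, ht⟩
    obtain ⟨n, hn⟩ := exists_tLS_pow_smul_mem_of_finset hE.1 hE.2.2 s
    refine hE.of_tLS_pow_smul_mem hU ht n fun u hu => ?_
    have hpow : ∀ k : ℕ, ∀ v ∈ E, ((tLS • θ) ^ k) v ∈ E := fun k v hv => by
      induction k with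
      | zero => simpa using hv
      | succ k ih => rw [pow_succ', Module.End.mul_apply]; exact hθ _ ih
    have hmem := hspan u hu
    clear hu
    induction hmem using Submodule.span_induction with
    | mem y hy =>
      obtain ⟨f, k, x, hx, rfl⟩ := hy
      rw [smul_comm, ← map_smul]
      exact hE.1 f _ (hpow k _ (hn x hx))
    | zero => simp
    | add x y _ _ hx hy => rw [smul_add]; exact Submodule.add_mem _ hx hy
    | smul c x _ hx => rw [laurentSeries_smul_complex_smul]; exact Submodule.smul_mem _ _ hx
  · intro h
    obtain ⟨s, hs⟩ := Module.Finite.fg_top (R := LaurentSeries ℂ) (M := M)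
    exact ⟨v0Span θ s, h _ (isV0Lattice_v0Span θ s hs), tLS_smul_mem_v0Span θ s⟩

end
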